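/- arXiv:1505.07536 — 2 statements merged into one kernel-verified Lean document; each statement's English description precedes it below -/
import Mathlib

section
/- Let O be a set of self-adjoint discrete Sturm-Liouville problems such that every problem in O has exactly k eigenvalues. Then for each 0≤n≤k-1 the n-th eigenvalue function λ_n: O→ℝ is continuous, where λ_n(P) denotes the n-th smallest eigenvalue (counting multiplicity) of the problem P. -/
open Polynomial Matrix

/-- The solution of `-∇(fₙ Δyₙ) + qₙ yₙ = λ wₙ yₙ` (`n ≥ 1`) with initial data
`y₀`, `f₀Δy₀ = d₀`, as a sequence of polynomials in `λ`. -/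
noncomputable def slSol (f q w : ℕ → ℝ) (y0 d0 : ℂ) : ℕ → Polynomial ℂ
  | 0 => C y0
  | 1 => C (y0 + d0 / (f 0 : ℂ))
  | n + 2 =>
      slSol f q w y0 d0 (n + 1) + C ((f (n + 1) : ℂ))⁻¹ *
        (C ((f n : ℂ)) * (slSol f q w y0 d0 (n + 1) - slSol f q w y0 d0 n)
          + C ((q (n + 1) : ℂ)) * slSol f q w y0 d0 (n + 1)
          - X * C ((w (n + 1) : ℂ)) * slSol f q w y0 d0 (n + 1))

/-- The characteristic polynomial `Γ` of the problem `(ω, A|B)`; its zeros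
(all real, counted with multiplicity) are the eigenvalues. -/
noncomputable def slCharPoly (N : ℕ) (f q w : ℕ → ℝ)
    (A B : Matrix (Fin 2) (Fin 2) ℂ) : Polynomial ℂ :=
  let φ := slSol f q w 1 0
  let ψ := slSol f q w 0 1
  let c11 := B 0 0 * A 1 1 - B 1 0 * A 0 1
  let c12 := -(B 0 0) * A 1 0 + B 1 0 * A 0 0
  let c21 := B 0 1 * A 1 1 - B 1 1 * A 0 1
  let c22 := -(B 0 1) * A 1 0 + B 1 1 * A 0 0
  C (A.det + B.det) + C c11 * φ N + C c12 * ψ N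
    + C (c21 * (f N : ℂ)) * (φ (N + 1) - φ N)
    + C (c22 * (f N : ℂ)) * (ψ (N + 1) - ψ N)

/-- The augmented `2×4` coefficient matrix `(A, B)` of the boundary condition. -/
def slAugment (A B : Matrix (Fin 2) (Fin 2) ℂ) : Matrix (Fin 2) (Fin 4) ℂ :=
  Matrix.of fun i j =>
    if h : (j : ℕ) < 2 then A i ⟨j, h⟩
    else B i ⟨(j : ℕ) - 2, by have := j.isLt; omega⟩

/-- `(ω, A|B)` is a self-adjoint discrete Sturm–Liouville problem on `[1, N]`:
`fₙ ≠ 0`, `wₙ > 0`, `rank (A, B) = 2` and `A J A* = B J B*`. -/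
def IsSLP (N : ℕ) (f q w : ℕ → ℝ) (A B : Matrix (Fin 2) (Fin 2) ℂ) : Prop :=
  (∀ n ≤ N, f n ≠ 0) ∧ (∀ n, 1 ≤ n → n ≤ N → 0 < w n) ∧
  (slAugment A B).rank = 2 ∧
  A * (!![0, 1; -1, 0] : Matrix (Fin 2) (Fin 2) ℂ) * Aᴴ
    = B * (!![0, 1; -1, 0] : Matrix (Fin 2) (Fin 2) ℂ) * Bᴴ

/-- The real zeros of `Γ` (with multiplicity), listed in increasing order. -/
noncomputable def eigList (Γ : Polynomial ℂ) : List ℝ :=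
  ((Γ.roots.filter (fun z => z.im = 0)).map Complex.re).sort (· ≤ ·)

/-- The `n`-th eigenvalue (0-indexed, in increasing order, with multiplicity). -/
noncomputable def nthEig (Γ : Polynomial ℂ) (n : ℕ) : ℝ :=
  (eigList Γ).getD n 0

/-- A problem: the equation data `(f, q, w)` together with the boundary-condition
coefficient matrices `(A, B)`. -/
abbrev SLProblem : Type :=
  (ℕ → ℝ) × (ℕ → ℝ) × (ℕ → ℝ) × Matrix (Fin 2) (Fin 2) ℂ × Matrix (Fin 2) (Fin 2) ℂ

/-- The characteristic polynomial of a problem. -/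
noncomputable def SLProblem.char (N : ℕ) (P : SLProblem) : Polynomial ℂ :=
  slCharPoly N P.1 P.2.1 P.2.2.1 P.2.2.2.1 P.2.2.2.2

section Helpers

open Filter Topology

/-- If all roots are real, the polynomial is recovered from its list of real roots. -/
lemma sl_roots_eq (p : Polynomial ℂ) (hr : ∀ z ∈ p.roots, z.im = 0) :
    ((eigList p).map (fun x : ℝ => (x : ℂ)) : Multiset ℂ) = p.roots := by
  unfold eigList
  rw [← Multiset.map_coe, Multiset.sort_eq, Multiset.map_map, Multiset.filter_eq_self.2 hr]
  conv_rhs => rw [← Multiset.map_id p.roots]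
  refine Multiset.map_congr rfl ?_
  intro z hz
  apply Complex.ext <;> simp [hr z hz]

lemma sl_ofFn_eig (p : Polynomial ℂ) (k : ℕ) (hl : (eigList p).length = k) :
    List.ofFn (fun i : Fin k => nthEig p i) = eigList p := by
  apply List.ext_getElem
  · simp [hl]
  · intro i h1 h2
    simp [nthEig, h2]

lemma sl_natDegree (p : Polynomial ℂ) (k : ℕ) (hr : ∀ z ∈ p.roots, z.im = 0)
    (hl : (eigList p).length = k) : p.natDegree = k := by
  rw [← IsAlgClosed.card_roots_eq_natDegree, ← sl_roots_eq p hr]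
  simpa using hl

lemma sl_factor (p : Polynomial ℂ) (k : ℕ) (hr : ∀ z ∈ p.roots, z.im = 0)
    (hl : (eigList p).length = k) :
    p = C (p.coeff k) * ∏ i : Fin k, (X - C ((nthEig p i : ℝ) : ℂ)) := by
  have h1 := Polynomial.C_leadingCoeff_mul_prod_multiset_X_sub_C
    (IsAlgClosed.card_roots_eq_natDegree (p := p))
  rw [← sl_roots_eq p hr, ← sl_ofFn_eig p k hl, leadingCoeff, sl_natDegree p k hr hl] at h1
  conv_lhs => rw [← h1]
  congr 1
  simp [List.map_ofFn, List.prod_ofFn]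

lemma sl_mono (p : Polynomial ℂ) (k : ℕ) (hl : (eigList p).length = k) :
    Monotone (fun i : Fin k => nthEig p i) := by
  rw [← List.sortedLE_ofFn_iff, sl_ofFn_eig p k hl]
  exact (Multiset.pairwise_sort _ _).sortedLE

lemma sl_unique (p : Polynomial ℂ) (hp : p ≠ 0) (k : ℕ) (hr : ∀ z ∈ p.roots, z.im = 0)
    (hl : (eigList p).length = k) (v : Fin k → ℝ) (hv : Monotone v) (c : ℂ)
    (h : p = C c * ∏ i : Fin k, (X - C ((v i : ℝ) : ℂ))) :
    v = fun i : Fin k => nthEig p i := by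
  have hc : c ≠ 0 := by
    rintro rfl
    simp [hp] at h
  have h1 : p.roots = ((List.ofFn v).map (fun x : ℝ => (x : ℂ)) : Multiset ℂ) := by
    rw [h, Polynomial.roots_C_mul _ hc, Polynomial.roots_prod]
    · simp only [roots_X_sub_C]
      rw [Multiset.bind_singleton, Fin.univ_val_map, List.map_ofFn]
      rfl
    · exact Finset.prod_ne_zero_iff.2 fun i _ => X_sub_C_ne_zero _
  rw [← sl_roots_eq p hr, ← Multiset.map_coe, ← Multiset.map_coe] at h1
  have h2 := Multiset.map_injective Complex.ofReal_injective h1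
  have h3 : eigList p = List.ofFn v := (Multiset.coe_eq_coe.1 h2).eq_of_sortedLE (Multiset.pairwise_sort _ _).sortedLE
    (List.sortedLE_ofFn_iff.2 hv)
  rw [← sl_ofFn_eig p k hl] at h3
  exact (List.ofFn_injective h3).symm

lemma sl_continuous {T : Type*} [TopologicalSpace T] (g : T → Polynomial ℂ) (O : Set T) (k : ℕ)
    (h0 : ∀ P ∈ O, g P ≠ 0) (hr : ∀ P ∈ O, ∀ z ∈ (g P).roots, z.im = 0)
    (hl : ∀ P ∈ O, (eigList (g P)).length = k)
    (hc : ∀ j, ContinuousOn (fun P => (g P).coeff j) O) :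
    ContinuousOn (fun P => fun i : Fin k => nthEig (g P) i) O := by
  intro P0 hP0
  have hdeg : ∀ P ∈ O, (g P).natDegree = k := fun P hP => sl_natDegree _ k (hr P hP) (hl P hP)
  have hlead : ∀ P ∈ O, (g P).coeff k ≠ 0 := by
    intro P hP
    have := leadingCoeff_ne_zero.2 (h0 P hP)
    rwa [leadingCoeff, hdeg P hP] at this
  let b : T → NNReal := fun P =>
    (Finset.range k).sup (fun j => ‖(g P).coeff j‖₊) / ‖(g P).coeff k‖₊ + 1
  have hb : ∀ P ∈ O, cauchyBound (g P) = b P := by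
    intro P hP
    simp only [cauchyBound, leadingCoeff, hdeg P hP, b]
  have hbt : Tendsto b (𝓝[O] P0) (𝓝 (b P0)) := by
    refine Tendsto.add (Tendsto.div ?_ ((hc k P0 hP0).nnnorm) ?_) tendsto_const_nhds
    · exact Tendsto.finset_sup_nhds_apply fun j _ => (hc j P0 hP0).nnnorm
    · simpa using hlead P0 hP0
  have hbl : ∀ᶠ P in 𝓝[O] P0, b P < b P0 + 1 :=
    hbt.eventually (eventually_lt_nhds (by simp))
  refine (isCompact_univ_pi (fun _ : Fin k => isCompact_Icc
    (a := -((b P0 + 1 : NNReal) : ℝ)) (b := ((b P0 + 1 : NNReal) : ℝ))))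
    |>.tendsto_nhds_of_unique_mapClusterPt ?_ ?_
  · filter_upwards [hbl, self_mem_nhdsWithin] with P hP hPO
    intro i _
    have hroot : (g P).IsRoot ((nthEig (g P) i : ℝ) : ℂ) := by
      have e := congrArg (eval ((nthEig (g P) i : ℝ) : ℂ))
        (sl_factor (g P) k (hr P hPO) (hl P hPO))
      rw [eval_mul, eval_prod, Finset.prod_eq_zero (Finset.mem_univ i) (by simp), mul_zero] at e
      exact e
    have h1 := (IsRoot.norm_lt_cauchyBound (h0 P hPO) hroot).trans (hb P hPO ▸ hP)
    have h2 : ‖((nthEig (g P) i : ℝ) : ℂ)‖ < ((b P0 + 1 : NNReal) : ℝ) := by exact_mod_cast h1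
    rw [Complex.norm_real, Real.norm_eq_abs, abs_lt] at h2
    exact ⟨h2.1.le, h2.2.le⟩
  · intro v _ hv
    obtain ⟨U, hU, hUv⟩ := mapClusterPt_iff_ultrafilter.1 hv
    have hUO : ∀ᶠ P in (U : Filter T), P ∈ O := hU self_mem_nhdsWithin
    have hUi : ∀ i : Fin k, Tendsto (fun P => nthEig (g P) i) U (𝓝 (v i)) := tendsto_pi_nhds.1 hUv
    have hcU : ∀ j, Tendsto (fun P => (g P).coeff j) U (𝓝 ((g P0).coeff j)) :=
      fun j => Tendsto.mono_left (hc j P0 hP0) hU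
    refine sl_unique (g P0) (h0 _ hP0) k (hr _ hP0) (hl _ hP0) v ?_ ((g P0).coeff k) ?_
    · intro i j hij
      refine le_of_tendsto_of_tendsto (hUi i) (hUi j) ?_
      filter_upwards [hUO] with P hP
      exact sl_mono (g P) k (hl P hP) hij
    · refine Polynomial.funext fun x => ?_
      have t1 : Tendsto (fun P => (g P).eval x) U (𝓝 ((g P0).eval x)) := by
        have : Tendsto (fun P => ∑ j ∈ Finset.range (k + 1), (g P).coeff j * x ^ j) U
            (𝓝 (∑ j ∈ Finset.range (k + 1), (g P0).coeff j * x ^ j)) :=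
          tendsto_finsetSum _ fun j _ => (hcU j).mul_const _
        rw [eval_eq_sum_range, hdeg P0 hP0]
        refine this.congr' ?_
        filter_upwards [hUO] with P hP
        rw [eval_eq_sum_range, hdeg P hP]
      have t2 : Tendsto (fun P => (g P).eval x) U
          (𝓝 ((C ((g P0).coeff k) * ∏ i : Fin k, (X - C ((v i : ℝ) : ℂ))).eval x)) := by
        have : Tendsto (fun P => (g P).coeff k * ∏ i : Fin k, (x - ((nthEig (g P) i : ℝ) : ℂ))) U
            (𝓝 ((g P0).coeff k * ∏ i : Fin k, (x - ((v i : ℝ) : ℂ)))) :=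
          (hcU k).mul (tendsto_finsetProd _ fun i _ => tendsto_const_nhds.sub
            ((Complex.continuous_ofReal.tendsto _).comp (hUi i)))
        simp only [eval_mul, eval_C, eval_prod, eval_sub, eval_X]
        refine this.congr' ?_
        filter_upwards [hUO] with P hP
        have := congrArg (eval x) (sl_factor (g P) k (hr P hP) (hl P hP))
        simp only [eval_mul, eval_C, eval_prod, eval_sub, eval_X] at this
        exact this.symm
      exact tendsto_nhds_unique t1 t2

/-- Continuity of the coefficients of the solution polynomials. -/
lemma sl_sol_coeff (N : ℕ) (O : Set SLProblem) (hO : ∀ P ∈ O, ∀ n ≤ N, P.1 n ≠ 0) (a b : ℂ) :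
    ∀ n ≤ N + 1, ∀ j, ContinuousOn (fun P : SLProblem =>
      (slSol P.1 P.2.1 P.2.2.1 a b n).coeff j) O := by
  have hf : ∀ n, ContinuousOn (fun P : SLProblem => ((P.1 n : ℝ) : ℂ)) O := fun n => by fun_prop
  have hq : ∀ n, ContinuousOn (fun P : SLProblem => ((P.2.1 n : ℝ) : ℂ)) O := fun n => by fun_prop
  have hw : ∀ n, ContinuousOn (fun P : SLProblem => ((P.2.2.1 n : ℝ) : ℂ)) O :=
    fun n => by fun_prop
  have hi : ∀ n ≤ N, ContinuousOn (fun P : SLProblem => ((P.1 n : ℝ) : ℂ)⁻¹) O :=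
    fun n hn => (hf n).inv₀ fun P hP => by exact_mod_cast hO P hP n hn
  intro n
  induction n using Nat.strong_induction_on with
  | _ n ih =>
    match n, ih with
    | 0, _ =>
      intro _ j
      simp only [slSol]
      fun_prop
    | 1, _ =>
      intro _ j
      simp only [slSol, coeff_C, div_eq_mul_inv]
      have := hi 0 (by omega)
      split_ifs <;> fun_prop
    | n + 2, ih =>
      intro hn j
      have h1 := ih (n + 1) (by omega) (by omega)
      have h2 := ih n (by omega) (by omega)
      have h3 := hi (n + 1) (by omega)
      have h4 := hf n
      have h5 := hq (n + 1)
      have h6 := hw (n + 1)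
      simp only [slSol, coeff_add, coeff_C_mul, coeff_sub, mul_assoc]
      have h7 : ContinuousOn (fun P : SLProblem =>
          (X * (C ((P.2.2.1 (n + 1) : ℝ) : ℂ) * slSol P.1 P.2.1 P.2.2.1 a b (n + 1))).coeff j) O := by
        cases j with
        | zero => simp only [coeff_X_mul_zero]; fun_prop
        | succ j =>
          simp only [coeff_X_mul, coeff_C_mul]
          exact h6.mul (h1 j)
      exact (h1 j).add (h3.mul (((h4.mul ((h1 j).sub (h2 j))).add (h5.mul (h1 j))).sub h7))

lemma sl_char_coeff (N : ℕ) (O : Set SLProblem) (hO : ∀ P ∈ O, ∀ n ≤ N, P.1 n ≠ 0) (j : ℕ) :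
    ContinuousOn (fun P : SLProblem => (P.char N).coeff j) O := by
  have h1 := sl_sol_coeff N O hO 1 0 N (by omega) j
  have h2 := sl_sol_coeff N O hO 1 0 (N + 1) (by omega) j
  have h3 := sl_sol_coeff N O hO 0 1 N (by omega) j
  have h4 := sl_sol_coeff N O hO 0 1 (N + 1) (by omega) j
  simp only [SLProblem.char, slCharPoly, coeff_add, coeff_C_mul, coeff_sub, coeff_C,
    Matrix.det_fin_two]
  have hA : ∀ i l, ContinuousOn (fun P : SLProblem => P.2.2.2.1 i l) O :=
    fun i l => by
      have : Continuous (fun P : SLProblem => P.2.2.2.1) := by fun_prop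
      exact (this.matrix_elem i l).continuousOn
  have hB : ∀ i l, ContinuousOn (fun P : SLProblem => P.2.2.2.2 i l) O :=
    fun i l => by
      have : Continuous (fun P : SLProblem => P.2.2.2.2) := by fun_prop
      exact (this.matrix_elem i l).continuousOn
  have hf : ContinuousOn (fun P : SLProblem => ((P.1 N : ℝ) : ℂ)) O := by fun_prop
  have := hA 0 0
  have := hA 0 1
  have := hA 1 0
  have := hA 1 1
  have := hB 0 0
  have := hB 0 1
  have := hB 1 0
  have := hB 1 1
  split_ifs <;> fun_prop

open scoped ComplexOrder in
lemma sl_rank_conj (M : Matrix (Fin 2) (Fin 4) ℂ) : Mᴴ.rank = M.rank :=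
  Matrix.rank_conjTranspose M

/-- The symplectic form vanishes on the kernel of a self-adjoint boundary condition. -/
lemma sl_bc (A B : Matrix (Fin 2) (Fin 2) ℂ) (hrank : (slAugment A B).rank = 2)
    (hAB : A * (!![0, 1; -1, 0] : Matrix (Fin 2) (Fin 2) ℂ) * Aᴴ
    = B * (!![0, 1; -1, 0] : Matrix (Fin 2) (Fin 2) ℂ) * Bᴴ) (u v : Fin 2 → ℂ)
    (h : A *ᵥ u + B *ᵥ v = 0) :
    v 0 * star (v 1) - star (v 0) * v 1 = u 0 * star (u 1) - star (u 0) * u 1 := by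
  let D : Matrix (Fin 4) (Fin 4) ℂ := !![0, 1, 0, 0; -1, 0, 0, 0; 0, 0, 0, -1; 0, 0, 1, 0]
  set M := slAugment A B with hM
  have hMe : M = !![A 0 0, A 0 1, B 0 0, B 0 1; A 1 0, A 1 1, B 1 0, B 1 1] := by
    ext i j
    fin_cases i <;> fin_cases j <;> simp [hM, slAugment]
  have hDD : D * D = -1 := by
    ext i j
    fin_cases i <;> fin_cases j <;> simp [D, Matrix.mul_apply, Fin.sum_univ_four]
  have hDs : Dᴴ = -D := by
    ext i j
    fin_cases i <;> fin_cases j <;> simp [D, Matrix.conjTranspose_apply]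
  have hMD : M * D * Mᴴ = 0 := by
    rw [hMe]
    ext i j
    have := congrFun (congrFun hAB i) j
    fin_cases i <;> fin_cases j <;>
      simp [D, Matrix.mul_apply, Fin.sum_univ_four, Fin.sum_univ_two,
        Matrix.conjTranspose_apply] at this ⊢ <;> linear_combination this
  have hDu : IsUnit D.det := by
    rw [← Matrix.isUnit_iff_isUnit_det]
    exact IsUnit.of_mul_eq_one (-D) (by rw [mul_neg, hDD, neg_neg])
  let x : Fin 4 → ℂ := ![u 0, u 1, v 0, v 1]
  have hx : M *ᵥ x = 0 := by
    rw [hMe]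
    ext i
    have := congrFun h i
    fin_cases i <;>
      simp [x, Matrix.mulVec, dotProduct, Fin.sum_univ_four, Fin.sum_univ_two] at this ⊢ <;>
      linear_combination this
  have hle : LinearMap.range (D * Mᴴ).mulVecLin ≤ LinearMap.ker M.mulVecLin := by
    rintro _ ⟨c, rfl⟩
    simp only [LinearMap.mem_ker, Matrix.mulVecLin_apply, Matrix.mulVec_mulVec]
    rw [← Matrix.mul_assoc, hMD, Matrix.zero_mulVec]
  have hr1 : Module.finrank ℂ (LinearMap.range (D * Mᴴ).mulVecLin) = 2 := by
    change (D * Mᴴ).rank = 2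
    rw [Matrix.rank_mul_eq_right_of_isUnit_det _ _ hDu, sl_rank_conj, hrank]
  have hr2 : Module.finrank ℂ (LinearMap.ker M.mulVecLin) = 2 := by
    have h1 := LinearMap.finrank_range_add_finrank_ker M.mulVecLin
    have h2 : Module.finrank ℂ (LinearMap.range M.mulVecLin) = 2 := hrank
    rw [h2] at h1
    simp at h1
    omega
  have heq := Submodule.eq_of_le_of_finrank_eq hle (hr1.trans hr2.symm)
  have hxm : x ∈ LinearMap.range (D * Mᴴ).mulVecLin := by
    rw [heq]
    exact hx
  obtain ⟨c, hc⟩ := hxm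
  rw [Matrix.mulVecLin_apply] at hc
  have key : star x ⬝ᵥ (D *ᵥ x) = 0 := by
    rw [← hc, Matrix.star_mulVec, ← Matrix.dotProduct_mulVec, Matrix.mulVec_mulVec,
      Matrix.mulVec_mulVec, Matrix.conjTranspose_mul, Matrix.conjTranspose_conjTranspose, hDs]
    have : M * -D * D * (D * Mᴴ) = 0 := by
      rw [Matrix.mul_assoc M, neg_mul, hDD, neg_neg, Matrix.mul_one, ← Matrix.mul_assoc, hMD]
    rw [this, Matrix.zero_mulVec, dotProduct_zero]
  simp [x, D, Matrix.mulVec, dotProduct, Fin.sum_univ_four] at key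
  simp
  linear_combination key

/-- Lagrange identity. -/
lemma sl_lagrange (N : ℕ) (f q w : ℕ → ℝ) (z : ℂ) (y d : ℕ → ℂ) (hf : ∀ n ≤ N, f n ≠ 0)
    (hd : ∀ n ≤ N, d n = f n * (y (n + 1) - y n))
    (hs : ∀ n < N, d (n + 1) = d n + (q (n + 1) - z * w (n + 1)) * y (n + 1)) :
    ∀ n ≤ N, y n * star (d n) - star (y n) * d n = y 0 * star (d 0) - star (y 0) * d 0
      + (z - star z) * ((∑ i ∈ Finset.range n, w (i + 1) * Complex.normSq (y (i + 1)) : ℝ) : ℂ) := by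
  intro n
  induction n with
  | zero => simp
  | succ n ih =>
    intro hn
    have h1 := ih (by omega)
    rw [Finset.sum_range_succ, hs n (by omega)]
    have h2 : y (n + 1) * star (d n) - star (y (n + 1)) * d n
        = y n * star (d n) - star (y n) * d n := by
      rw [hd n (by omega)]
      simp
      ring
    rw [Complex.ofReal_add, Complex.ofReal_mul, Complex.normSq_eq_conj_mul_self]
    simp only [star_add, star_mul', star_sub, Complex.star_def, Complex.conj_ofReal] at *
    linear_combination h1 + h2

lemma sl_wronskian (N : ℕ) (f q w : ℕ → ℝ) (z : ℂ) (y d y' d' : ℕ → ℂ)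
    (hd : ∀ n ≤ N, d n = f n * (y (n + 1) - y n))
    (hs : ∀ n < N, d (n + 1) = d n + (q (n + 1) - z * w (n + 1)) * y (n + 1))
    (hd' : ∀ n ≤ N, d' n = f n * (y' (n + 1) - y' n))
    (hs' : ∀ n < N, d' (n + 1) = d' n + (q (n + 1) - z * w (n + 1)) * y' (n + 1)) :
    ∀ n ≤ N, y n * d' n - y' n * d n = y 0 * d' 0 - y' 0 * d 0 := by
  intro n
  induction n with
  | zero => simp
  | succ n ih =>
    intro hn
    rw [← ih (by omega), hs n (by omega), hs' n (by omega), hd n (by omega), hd' n (by omega)]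
    ring

lemma sl_sol_d0 (f q w : ℕ → ℝ) (a b z : ℂ) (h0 : f 0 ≠ 0) :
    (f 0 : ℂ) * ((slSol f q w a b 1).eval z - (slSol f q w a b 0).eval z) = b := by
  have : (f 0 : ℂ) ≠ 0 := by exact_mod_cast h0
  simp [slSol]
  field_simp

lemma sl_sol_step (f q w : ℕ → ℝ) (a b z : ℂ) (n : ℕ) (h0 : f (n + 1) ≠ 0) :
    (f (n + 1) : ℂ) * ((slSol f q w a b (n + 2)).eval z - (slSol f q w a b (n + 1)).eval z)
     = (f n : ℂ) * ((slSol f q w a b (n + 1)).eval z - (slSol f q w a b n).eval z)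
      + (q (n + 1) - z * w (n + 1)) * (slSol f q w a b (n + 1)).eval z := by
  have : (f (n + 1) : ℂ) ≠ 0 := by exact_mod_cast h0
  rw [slSol]
  simp only [eval_add, eval_mul, eval_C, eval_sub, eval_X]
  field_simp
  ring

/-- All zeros of the characteristic polynomial are real. -/
lemma sl_real (N : ℕ) (hN : 2 ≤ N) (f q w : ℕ → ℝ) (A B : Matrix (Fin 2) (Fin 2) ℂ)
    (hP : IsSLP N f q w A B) (z : ℂ) (hz : (slCharPoly N f q w A B).eval z = 0) : z.im = 0 := by
  obtain ⟨hf, hw, hrank, hAB⟩ := hP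
  let φ : ℕ → ℂ := fun n => (slSol f q w 1 0 n).eval z
  let ψ : ℕ → ℂ := fun n => (slSol f q w 0 1 n).eval z
  let dφ : ℕ → ℂ := fun n => f n * (φ (n + 1) - φ n)
  let dψ : ℕ → ℂ := fun n => f n * (ψ (n + 1) - ψ n)
  have hφ0 : φ 0 = 1 := by simp [φ, slSol]
  have hψ0 : ψ 0 = 0 := by simp [ψ, slSol]
  have hdφ0 : dφ 0 = 0 := sl_sol_d0 f q w 1 0 z (hf 0 (by omega))
  have hdψ0 : dψ 0 = 1 := sl_sol_d0 f q w 0 1 z (hf 0 (by omega))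
  have hsφ : ∀ n < N, dφ (n + 1) = dφ n + (q (n + 1) - z * w (n + 1)) * φ (n + 1) :=
    fun n hn => sl_sol_step f q w 1 0 z n (hf _ (by omega))
  have hsψ : ∀ n < N, dψ (n + 1) = dψ n + (q (n + 1) - z * w (n + 1)) * ψ (n + 1) :=
    fun n hn => sl_sol_step f q w 0 1 z n (hf _ (by omega))
  have hW := sl_wronskian N f q w z φ dφ ψ dψ (fun _ _ => rfl) hsφ (fun _ _ => rfl) hsψ N le_rfl
  rw [hφ0, hψ0, hdψ0] at hW
  have hdet : (A + B * !![φ N, ψ N; dφ N, dψ N]).det = 0 := by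
    rw [← hz]
    simp only [slCharPoly, eval_add, eval_mul, eval_C, eval_sub]
    simp only [Matrix.det_fin_two, Matrix.add_apply, Matrix.mul_apply, Fin.sum_univ_two]
    simp only [Matrix.of_apply, Matrix.cons_val', Matrix.cons_val_zero, Matrix.cons_val_one,
      Matrix.cons_val_fin_one]
    change _ = A 0 0 * A 1 1 - A 0 1 * A 1 0 + (B 0 0 * B 1 1 - B 0 1 * B 1 0)
      + (B 0 0 * A 1 1 - B 1 0 * A 0 1) * φ N + (-(B 0 0) * A 1 0 + B 1 0 * A 0 0) * ψ N
      + (B 0 1 * A 1 1 - B 1 1 * A 0 1) * f N * (φ (N + 1) - φ N)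
      + (-(B 0 1) * A 1 0 + B 1 1 * A 0 0) * f N * (ψ (N + 1) - ψ N)
    have e1 : (f N : ℂ) * (φ (N + 1) - φ N) = dφ N := rfl
    have e2 : (f N : ℂ) * (ψ (N + 1) - ψ N) = dψ N := rfl
    rw [mul_assoc _ (f N : ℂ), mul_assoc _ (f N : ℂ), e1, e2]
    linear_combination (B 0 0 * B 1 1 - B 0 1 * B 1 0) * hW
  obtain ⟨c, hc0, hc⟩ := Matrix.exists_mulVec_eq_zero_iff.2 hdet
  let y : ℕ → ℂ := fun n => c 0 * φ n + c 1 * ψ n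
  let d : ℕ → ℂ := fun n => c 0 * dφ n + c 1 * dψ n
  have hd : ∀ n ≤ N, d n = f n * (y (n + 1) - y n) := by
    intro n _
    simp only [d, y, dφ, dψ]
    ring
  have hs : ∀ n < N, d (n + 1) = d n + (q (n + 1) - z * w (n + 1)) * y (n + 1) := by
    intro n hn
    simp only [d, y]
    rw [hsφ n hn, hsψ n hn]
    ring
  have hy0 : y 0 = c 0 := by simp [y, hφ0, hψ0]
  have hd0 : d 0 = c 1 := by simp [d, hdφ0, hdψ0]
  have hL := sl_lagrange N f q w z y d hf hd hs N le_rfl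
  have hbc := sl_bc A B hrank hAB ![y 0, d 0] ![y N, d N] (by
    rw [← hc, Matrix.add_mulVec, ← Matrix.mulVec_mulVec]
    have e1 : (![y 0, d 0] : Fin 2 → ℂ) = c := by
      ext i; fin_cases i <;> simp [hy0, hd0]
    have e2 : (![y N, d N] : Fin 2 → ℂ) = !![φ N, ψ N; dφ N, dψ N] *ᵥ c := by
      ext i
      fin_cases i <;> simp [Matrix.mulVec, dotProduct, Fin.sum_univ_two, y, d] <;> ring
    rw [e1, e2])
  simp only [Matrix.cons_val_zero, Matrix.cons_val_one] at hbc
  rw [hbc] at hL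
  have hprod := left_eq_add.1 hL
  rcases mul_eq_zero.1 hprod with h | h
  · have := congrArg Complex.im h
    simp at this
    linarith
  · exfalso
    have h' : ∑ i ∈ Finset.range N, w (i + 1) * Complex.normSq (y (i + 1)) = 0 := by
      exact_mod_cast h
    rw [Finset.sum_eq_zero_iff_of_nonneg] at h'
    · have hy : ∀ i < N, y (i + 1) = 0 := by
        intro i hi
        have h1 := h' i (Finset.mem_range.2 hi)
        rcases mul_eq_zero.1 h1 with h2 | h2
        · exact absurd h2 (hw (i + 1) (by omega) (by omega)).ne'
        · exact Complex.normSq_eq_zero.1 h2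
      have y1 : y 1 = 0 := hy 0 (by omega)
      have y2 : y 2 = 0 := hy 1 (by omega)
      have d1 : d 1 = 0 := by rw [hd 1 (by omega), y1, y2]; simp
      have d0 : d 0 = 0 := by
        have := hs 0 (by omega)
        simpa [d1, y1] using this.symm
      have y0 : y 0 = 0 := by
        have h3 := hd 0 (by omega)
        have h4 : (f 0 : ℂ) ≠ 0 := by exact_mod_cast hf 0 (by omega)
        simpa [d0, y1, h4] using h3
      apply hc0
      ext i
      fin_cases i
      · simpa [y0] using hy0.symm
      · simpa [d0] using hd0.symm
    · intro i hi
      have := hw (i + 1) (by omega) (by have := Finset.mem_range.1 hi; omega)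
      exact mul_nonneg this.le (Complex.normSq_nonneg _)

end Helpers

/-- If every problem in a set `O` of self-adjoint discrete Sturm–Liouville problems has
exactly `k` eigenvalues, then for each `0 ≤ n ≤ k-1` the `n`-th eigenvalue function
`λₙ : O → ℝ` is continuous. -/
theorem nthEig_continuousOn (N k : ℕ) (hN : 2 ≤ N) (O : Set SLProblem)
    (hO : ∀ P ∈ O, IsSLP N P.1 P.2.1 P.2.2.1 P.2.2.2.1 P.2.2.2.2)
    (hk : ∀ P ∈ O, P.char N ≠ 0 ∧ (eigList (P.char N)).length = k)
    (n : ℕ) (hn : n < k) :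
    ContinuousOn (fun P : SLProblem => nthEig (P.char N) n) O := by
  have h := sl_continuous (fun P : SLProblem => P.char N) O k (fun P hP => (hk P hP).1)
    (fun P hP z hz => sl_real N hN _ _ _ _ _ (hO P hP) z (Polynomial.isRoot_of_mem_roots hz))
    (fun P hP => (hk P hP).2) (fun j => sl_char_coeff N O (fun P hP => (hO P hP).1) j)
  exact continuousOn_pi.1 h ⟨n, hn⟩
end

section
/- Suppose every problem in a connected set O of self-adjoint discrete Sturm-Liouville problems has exactly k eigenvalues, exactly m of which lie in the open interval (r_1,r_2), with no eigenvalue equal to r_1 or r_2, where m<k. Then for each index 1≤i≤k-m, the i-th eigenvalue outside [r_1,r_2] (in increasing order), as a function on O, takes values either entirely in (-∞,r_1) or entirely in (r_2,+∞). -/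
open Polynomial Matrix

/-- The `i`-th (1-indexed, increasing order, with multiplicity) eigenvalue lying outside
the interval `[r₁, r₂]`. -/
noncomputable def hatEig (N : ℕ) (r1 r2 : ℝ) (P : SLProblem) (i : ℕ) : ℝ :=
  ((eigList (P.char N)).filter (fun x => x < r1 ∨ r2 < x)).getD (i - 1) 0


lemma slSol_rec (f q w : ℕ → ℝ) (y0 d0 l : ℂ) (n : ℕ) (hf : f (n+1) ≠ 0) :
    (f (n+1) : ℂ) * ((slSol f q w y0 d0 (n+2)).eval l - (slSol f q w y0 d0 (n+1)).eval l)
     = (f n : ℂ) * ((slSol f q w y0 d0 (n+1)).eval l - (slSol f q w y0 d0 n).eval l)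
      + ((q (n+1) : ℂ) - l * (w (n+1) : ℂ)) * (slSol f q w y0 d0 (n+1)).eval l := by
  have h : (f (n+1) : ℂ) ≠ 0 := by exact_mod_cast hf
  rw [slSol]
  simp only [eval_add, eval_mul, eval_sub, eval_C, eval_X]
  field_simp
  ring

lemma slSol_wronskian (f q w : ℕ → ℝ) (l : ℂ) (N : ℕ) (hf : ∀ n ≤ N, f n ≠ 0) :
    ∀ n ≤ N, (f n : ℂ) * ((slSol f q w 1 0 n).eval l * (slSol f q w 0 1 (n+1)).eval l
      - (slSol f q w 0 1 n).eval l * (slSol f q w 1 0 (n+1)).eval l) = 1 := by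
  intro n
  induction n with
  | zero =>
    intro hn
    have h : (f 0 : ℂ) ≠ 0 := by exact_mod_cast hf 0 hn
    simp [slSol, h]
  | succ n ih =>
    intro hn
    have ih := ih (by omega)
    have h1 := slSol_rec f q w 1 0 l n (hf _ hn)
    have h2 := slSol_rec f q w 0 1 l n (hf _ hn)
    linear_combination ih + (slSol f q w 1 0 (n+1)).eval l * h2
      - (slSol f q w 0 1 (n+1)).eval l * h1

open scoped ComplexOrder in
lemma bc_form (A B : Matrix (Fin 2) (Fin 2) ℂ) (hr : (slAugment A B).rank = 2)
    (hs : A * (!![0, 1; -1, 0] : Matrix (Fin 2) (Fin 2) ℂ) * Aᴴ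
      = B * (!![0, 1; -1, 0] : Matrix (Fin 2) (Fin 2) ℂ) * Bᴴ)
    (a b c d : ℂ) (h : A *ᵥ ![a, b] + B *ᵥ ![c, d] = 0) :
    star a * b - star b * a = star c * d - star d * c := by
  set M := slAugment A B with hM
  let J : Matrix (Fin 4) (Fin 4) ℂ := !![0,1,0,0;-1,0,0,0;0,0,0,-1;0,0,1,0]
  have hJ2 : J * (-J) = 1 := by
    ext i j
    fin_cases i <;> fin_cases j <;> simp [J, Matrix.mul_apply, Fin.sum_univ_four]
  have hJ : IsUnit J.det := by
    have := congrArg Matrix.det hJ2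
    rw [Matrix.det_mul, Matrix.det_one] at this
    exact IsUnit.of_mul_eq_one _ this
  have e : ∀ i j, -(A i 1 * star (A j 0)) + A i 0 * star (A j 1)
      = -(B i 1 * star (B j 0)) + B i 0 * star (B j 1) := by
    intro i j
    have := congrFun (congrFun hs i) j
    simp only [Matrix.mul_apply, Fin.sum_univ_two, Matrix.conjTranspose_apply] at this
    simp [Matrix.of_apply] at this
    simpa using this
  have hMK : M * (J * Mᴴ) = 0 := by
    rw [← Matrix.mul_assoc]
    ext i j
    have := e i j
    simp only [Matrix.mul_apply, Fin.sum_univ_four, Matrix.conjTranspose_apply]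
    simp [J, hM, slAugment]
    simp only [Complex.star_def] at this
    linear_combination this
  have hK : (J * Mᴴ).rank = 2 := by
    rw [Matrix.rank_mul_eq_right_of_isUnit_det _ _ hJ, Matrix.rank_conjTranspose, hr]
  have hle : LinearMap.range (J * Mᴴ).mulVecLin ≤ LinearMap.ker M.mulVecLin := by
    rintro _ ⟨v, rfl⟩
    simp only [LinearMap.mem_ker, Matrix.mulVecLin_apply, Matrix.mulVec_mulVec, hMK, Matrix.zero_mulVec]
  have heq := Submodule.eq_of_le_of_finrank_eq hle (by
    have h1 := LinearMap.finrank_range_add_finrank_ker M.mulVecLin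
    simp only [Module.finrank_fintype_fun_eq_card, Fintype.card_fin] at h1
    unfold Matrix.rank at hr hK
    omega)
  have hmem : ![a,b,c,d] ∈ LinearMap.ker M.mulVecLin := by
    rw [LinearMap.mem_ker, Matrix.mulVecLin_apply]
    ext i
    have := congrFun h i
    simp only [Pi.add_apply, Matrix.mulVec, dotProduct, Fin.sum_univ_two] at this
    simp at this
    simp [Matrix.mulVec, dotProduct, Fin.sum_univ_four, hM, slAugment]
    linear_combination this
  rw [← heq] at hmem
  obtain ⟨v, hv⟩ := hmem
  have g : ∀ i, (J * Mᴴ).mulVecLin v i = ![a,b,c,d] i := fun i => by rw [hv]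
  simp only [Matrix.mulVecLin_apply, Matrix.mulVec, dotProduct, Fin.sum_univ_two,
    Matrix.mul_apply, Fin.sum_univ_four, Matrix.conjTranspose_apply] at g
  have g0 := g 0
  have g1 := g 1
  have g2 := g 2
  have g3 := g 3
  simp [J, hM, slAugment] at g0 g1 g2 g3
  have e00 := e 0 0
  have e01 := e 0 1
  have e10 := e 1 0
  have e11 := e 1 1
  simp only [Complex.star_def] at e00 e01 e10 e11 ⊢
  subst g0 g1 g2 g3
  simp
  linear_combination (v 0 * (starRingEnd ℂ) (v 0)) * e00 + (v 1 * (starRingEnd ℂ) (v 0)) * e01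
    + (v 0 * (starRingEnd ℂ) (v 1)) * e10 + (v 1 * (starRingEnd ℂ) (v 1)) * e11

lemma char_root_real (N : ℕ) (hN : 2 ≤ N) (f q w : ℕ → ℝ) (A B : Matrix (Fin 2) (Fin 2) ℂ)
    (h : IsSLP N f q w A B) (l : ℂ) (hl : (slCharPoly N f q w A B).eval l = 0) : l.im = 0 := by
  obtain ⟨hf, hw, hr, hs⟩ := h
  set φ : ℕ → ℂ := fun n => (slSol f q w 1 0 n).eval l with hφ
  set ψ : ℕ → ℂ := fun n => (slSol f q w 0 1 n).eval l with hψ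
  let Φ : Matrix (Fin 2) (Fin 2) ℂ :=
    !![φ N, ψ N; f N * (φ (N+1) - φ N), f N * (ψ (N+1) - ψ N)]
  have hW := slSol_wronskian f q w l N hf N le_rfl
  have hdet : (A + B * Φ).det = 0 := by
    rw [← hl]
    simp only [slCharPoly, eval_add, eval_mul, eval_sub, eval_C, Matrix.det_fin_two,
      Matrix.add_apply, Matrix.mul_apply, Fin.sum_univ_two]
    simp [Φ, hφ, hψ]
    linear_combination (B 0 0 * B 1 1 - B 0 1 * B 1 0) * hW
  obtain ⟨v, hv0, hv⟩ := Matrix.exists_mulVec_eq_zero_iff.mpr hdet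
  set y : ℕ → ℂ := fun n => v 0 * φ n + v 1 * ψ n with hy
  have hrec : ∀ n, n + 1 ≤ N → (f (n+1) : ℂ) * (y (n+2) - y (n+1))
      = (f n : ℂ) * (y (n+1) - y n) + ((q (n+1) : ℂ) - l * (w (n+1) : ℂ)) * y (n+1) := by
    intro n hn
    have h1 := slSol_rec f q w 1 0 l n (hf _ hn)
    have h2 := slSol_rec f q w 0 1 l n (hf _ hn)
    simp only [hy, hφ, hψ]
    linear_combination v 0 * h1 + v 1 * h2
  have hy0 : y 0 = v 0 := by simp [hy, hφ, hψ, slSol]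
  have hd0 : (f 0 : ℂ) * (y 1 - y 0) = v 1 := by
    have h : (f 0 : ℂ) ≠ 0 := by exact_mod_cast hf 0 (by omega)
    simp [hy, hφ, hψ, slSol]
    field_simp
  have hbc := bc_form A B hr hs (y 0) (f 0 * (y 1 - y 0)) (y N) (f N * (y (N+1) - y N)) (by
    rw [hd0, hy0, ← hv, Matrix.add_mulVec, ← Matrix.mulVec_mulVec]
    congr 2
    · ext i; fin_cases i <;> rfl
    · ext i
      fin_cases i <;> simp [Φ, hy, Matrix.mulVec, dotProduct, Fin.sum_univ_two] <;> ring)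
  have hLag : ∀ n ≤ N, star (y n) * (f n * (y (n+1) - y n)) - star (f n * (y (n+1) - y n)) * y n
      = star (y 0) * (f 0 * (y 1 - y 0)) - star (f 0 * (y 1 - y 0)) * y 0
        + (star l - l) * ((∑ j ∈ Finset.range n, w (j+1) * ‖y (j+1)‖^2 : ℝ) : ℂ) := by
    intro n
    induction n with
    | zero => intro _; simp
    | succ n ih =>
      intro hn
      have ih := ih (by omega)
      have h1 := hrec n hn
      have h2 := congrArg star h1
      rw [Finset.sum_range_succ]
      have h3 : ((‖y (n+1)‖^2 : ℝ) : ℂ) = star (y (n+1)) * y (n+1) := by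
        have := Complex.conj_mul' (y (n+1))
        push_cast
        exact this.symm
      push_cast at h3 ih ⊢
      rw [h3]
      simp only [star_mul', star_add, star_sub, Complex.star_def, Complex.conj_ofReal, map_mul, map_add, map_sub] at h1 h2 ih ⊢
      linear_combination ih + (starRingEnd ℂ) (y (n+1)) * h1 - y (n+1) * h2
  have hL := hLag N le_rfl
  rw [← hbc] at hL
  have hz : (star l - l) * ((∑ j ∈ Finset.range N, w (j+1) * ‖y (j+1)‖^2 : ℝ) : ℂ) = 0 := by
    linear_combination -hL
  rcases mul_eq_zero.mp hz with hz | hz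
  · have : star l = l := by linear_combination hz
    exact Complex.conj_eq_iff_im.mp this
  · exfalso
    have hz : ∑ j ∈ Finset.range N, w (j+1) * ‖y (j+1)‖^2 = 0 := by exact_mod_cast hz
    rw [Finset.sum_eq_zero_iff_of_nonneg] at hz
    · have hyz : ∀ n, n + 1 ≤ N → y (n+1) = 0 := by
        intro n hn
        have h1 := hz n (by simpa using hn)
        have h2 := hw (n+1) (by omega) hn
        rcases mul_eq_zero.mp h1 with h1 | h1
        · exact absurd h1 h2.ne'
        · simpa using h1
      have y1 := hyz 0 (by omega)
      have y2 := hyz 1 (by omega)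
      have h1 := hrec 0 (by omega)
      have h0 : (f 0 : ℂ) ≠ 0 := by exact_mod_cast hf 0 (by omega)
      simp only [zero_add] at y1 y2 h1
      norm_num at y2
      rw [y1, y2] at h1
      have y0 : y 0 = 0 := by simpa [h0] using h1
      apply hv0
      ext i
      fin_cases i
      · simpa [y0] using hy0.symm
      · simpa [y0, y1] using hd0.symm
    · intro j hj
      have := hw (j+1) (by omega) (by simpa using hj)
      positivity

open Filter Topology

lemma continuousOn_rootCount {Y : Type*} [TopologicalSpace Y] (O : Set Y) (p : Y → Polynomial ℂ)
    (k : ℕ) (r : ℝ) (hc : ∀ j, ContinuousOn (fun P => (p P).coeff j) O)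
    (h0 : ∀ P ∈ O, p P ≠ 0) (hd : ∀ P ∈ O, (p P).natDegree = k)
    (hre : ∀ P ∈ O, ∀ z ∈ (p P).roots, z.re ≠ r) :
    ContinuousOn (fun P => (p P).roots.countP (fun z => z.re < r)) O := by
  classical
  have hx : ∀ P, ∃ x : Fin k → ℂ, P ∈ O → (p P).roots = Finset.univ.val.map x := by
    intro P
    by_cases hP : P ∈ O
    · have hcard : (p P).roots.toList.length = k := by
        rw [Multiset.length_toList, ← hd P hP]
        exact (IsAlgClosed.splits (p P)).natDegree_eq_card_roots.symm
      refine ⟨fun i => (p P).roots.toList.get (Fin.cast hcard.symm i), fun _ => ?_⟩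
      rw [Fin.univ_val_map]
      conv_lhs => rw [← Multiset.coe_toList (p P).roots]
      congr 1
      apply List.ext_get
      · simp [hcard]
      · intro n h1 h2
        simp
    · exact ⟨0, fun h => absurd h hP⟩
  choose x hx using hx
  have hev : ∀ P ∈ O, ∀ z, (p P).eval z = (p P).coeff k * ∏ i, (z - x P i) := by
    intro P hP z
    have h1 := (IsAlgClosed.splits (p P)).eq_prod_roots
    conv_lhs => rw [h1]
    rw [hx P hP, Multiset.map_map, eval_mul, eval_C, Polynomial.leadingCoeff, hd P hP]
    congr 1
    change eval z (∏ i, (X - C (x P i))) = _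
    rw [eval_prod]
    simp
  have hcount : ∀ P ∈ O, (p P).roots.countP (fun z => z.re < r)
      = (Finset.univ.filter (fun i => (x P i).re < r)).card := by
    intro P hP
    rw [hx P hP, Multiset.countP_map]
    rfl
  have hev2 : ∀ P ∈ O, ∀ z, (p P).eval z = ∑ j ∈ Finset.range (k+1), (p P).coeff j * z ^ j := by
    intro P hP z
    rw [eval_eq_sum_range, hd P hP]
  intro P hP
  rw [ContinuousWithinAt, nhds_discrete ℕ, tendsto_pure]
  change {Q | (p Q).roots.countP (fun z => z.re < r) = (p P).roots.countP (fun z => z.re < r)}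
    ∈ 𝓝[O] P
  rw [mem_iff_ultrafilter]
  intro U hU
  have hUO : ∀ᶠ Q in (U : Filter Y), Q ∈ O := hU self_mem_nhdsWithin
  have hlead : ∀ Q ∈ O, (p Q).coeff k ≠ 0 := by
    intro Q hQ
    rw [← hd Q hQ]
    exact leadingCoeff_ne_zero.mpr (h0 Q hQ)
  have hct : ∀ j, Tendsto (fun Q => (p Q).coeff j) U (𝓝 ((p P).coeff j)) :=
    fun j => (hc j P hP).mono_left hU
  -- bound
  have hb : ∃ R : NNReal, ∀ᶠ Q in (U : Filter Y), ∀ i, x Q i ∈ Metric.closedBall (0 : ℂ) R := by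
    have ht : Tendsto (fun Q => (Finset.range k).sup (fun j => ‖(p Q).coeff j‖₊) / ‖(p Q).coeff k‖₊ + 1)
        U (𝓝 ((Finset.range k).sup (fun j => ‖(p P).coeff j‖₊) / ‖(p P).coeff k‖₊ + 1)) := by
      refine Tendsto.add_const 1 (Tendsto.div ?_ (hct k).nnnorm (by simpa using hlead P hP))
      exact Tendsto.finset_sup_nhds_apply (fun j _ => (hct j).nnnorm)
    refine ⟨(Finset.range k).sup (fun j => ‖(p P).coeff j‖₊) / ‖(p P).coeff k‖₊ + 1 + 1, ?_⟩
    filter_upwards [hUO, ht.eventually_lt_const (lt_add_one _)] with Q hQ hlt i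
    have hroot : (p Q).IsRoot (x Q i) := by
      have : x Q i ∈ (p Q).roots := by
        rw [hx Q hQ]
        exact Multiset.mem_map_of_mem _ (Finset.mem_univ i)
      exact isRoot_of_mem_roots this
    have h1 := hroot.norm_lt_cauchyBound (h0 Q hQ)
    rw [cauchyBound, Polynomial.leadingCoeff, hd Q hQ] at h1
    have h2 := (h1.trans hlt).le
    rw [mem_closedBall_zero_iff]
    exact_mod_cast h2
  obtain ⟨R, hR⟩ := hb
  have hL : ∀ i, ∃ L : ℂ, Tendsto (fun Q => x Q i) U (𝓝 L) := by
    intro i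
    have hcomp := isCompact_closedBall (0 : ℂ) R
    obtain ⟨L, -, hL⟩ := hcomp.ultrafilter_le_nhds (U.map (fun Q => x Q i)) (by
      rw [le_principal_iff]
      exact hR.mono (fun Q h => h i))
    exact ⟨L, hL⟩
  choose L hL using hL
  have hPev : p P = C ((p P).coeff k) * ∏ i, (X - C (L i)) := by
    apply Polynomial.funext
    intro z
    have t1 : Tendsto (fun Q => (p Q).coeff k * ∏ i, (z - x Q i)) U
        (𝓝 ((p P).coeff k * ∏ i, (z - L i))) :=
      (hct k).mul (tendsto_finsetProd _ (fun i _ => tendsto_const_nhds.sub (hL i)))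
    have t2 : Tendsto (fun Q => ∑ j ∈ Finset.range (k+1), (p Q).coeff j * z ^ j) U
        (𝓝 (∑ j ∈ Finset.range (k+1), (p P).coeff j * z ^ j)) :=
      tendsto_finsetSum _ (fun j _ => (hct j).mul_const _)
    have t3 := t2.congr' (by
      filter_upwards [hUO] with Q hQ
      rw [← hev2 Q hQ, hev Q hQ])
    rw [hev2 P hP, tendsto_nhds_unique t3 t1]
    simp [eval_prod]
  have hroots : (p P).roots = Finset.univ.val.map L := by
    rw [hPev, roots_C_mul _ (hlead P hP)]
    have h := roots_multiset_prod_X_sub_C (Finset.univ.val.map L)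
    rw [Multiset.map_map] at h
    exact h
  have hmem : ∀ i, L i ∈ (p P).roots := by
    intro i
    rw [hroots]
    exact Multiset.mem_map_of_mem _ (Finset.mem_univ i)
  have hiff : ∀ i, ∀ᶠ Q in (U : Filter Y), ((x Q i).re < r ↔ (L i).re < r) := by
    intro i
    have ht : Tendsto (fun Q => (x Q i).re) U (𝓝 (L i).re) :=
      (Complex.continuous_re.tendsto _).comp (hL i)
    rcases lt_or_gt_of_ne (hre P hP _ (hmem i)) with h | h
    · filter_upwards [ht.eventually_lt_const h] with Q hQ
      simp [hQ, h]
    · filter_upwards [ht.eventually_const_lt h] with Q hQ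
      exact iff_of_false (not_lt.mpr hQ.le) (not_lt.mpr h.le)
  filter_upwards [hUO, eventually_all.mpr hiff] with Q hQ hi
  change (p Q).roots.countP _ = (p P).roots.countP _
  rw [hcount Q hQ, hroots, Multiset.countP_map]
  simp only [hi]
  rfl

lemma slSol_coeff_cont (N : ℕ) (O : Set SLProblem) (hf : ∀ P ∈ O, ∀ n ≤ N, P.1 n ≠ 0)
    (y0 d0 : ℂ) : ∀ n, (n ≤ N + 1 → ∀ j, ContinuousOn
      (fun P : SLProblem => (slSol P.1 P.2.1 P.2.2.1 y0 d0 n).coeff j) O) ∧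
      (n + 1 ≤ N + 1 → ∀ j, ContinuousOn
      (fun P : SLProblem => (slSol P.1 P.2.1 P.2.2.1 y0 d0 (n+1)).coeff j) O) := by
  have cf : ∀ n, ContinuousOn (fun P : SLProblem => (P.1 n : ℂ)) O := fun n => by fun_prop
  have cq : ∀ n, ContinuousOn (fun P : SLProblem => (P.2.1 n : ℂ)) O := fun n => by fun_prop
  have cw : ∀ n, ContinuousOn (fun P : SLProblem => (P.2.2.1 n : ℂ)) O := fun n => by fun_prop
  have ci : ∀ n ≤ N, ContinuousOn (fun P : SLProblem => (P.1 n : ℂ)⁻¹) O := fun n hn =>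
    (cf n).inv₀ (fun P hP => by exact_mod_cast hf P hP n hn)
  intro n
  induction n with
  | zero =>
    refine ⟨fun _ j => ?_, fun _ j => ?_⟩
    · simp only [slSol]; exact continuousOn_const
    · simp only [slSol, zero_add, coeff_C]
      split_ifs
      · simp only [div_eq_mul_inv]
        exact continuousOn_const.add (continuousOn_const.mul (ci 0 (by omega)))
      · exact continuousOn_const
  | succ n ih =>
    refine ⟨ih.2, fun hn j => ?_⟩
    have i1 := ih.1 (by omega)
    have i2 := ih.2 (by omega)
    have ci := ci (n+1) (by omega)
    cases j with
    | zero =>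
      simp only [slSol, mul_assoc, coeff_add, coeff_sub, coeff_C_mul, coeff_X_mul_zero]
      exact (i2 _).add (ci.mul ((((cf _).mul ((i2 _).sub (i1 _))).add ((cq _).mul (i2 _))).sub
        continuousOn_const))
    | succ j =>
      simp only [slSol, mul_assoc, coeff_add, coeff_sub, coeff_C_mul, coeff_X_mul]
      exact (i2 _).add (ci.mul ((((cf _).mul ((i2 _).sub (i1 _))).add ((cq _).mul (i2 _))).sub
        ((cw _).mul (i2 _))))

lemma char_coeff_cont (N : ℕ) (O : Set SLProblem) (hf : ∀ P ∈ O, ∀ n ≤ N, P.1 n ≠ 0) (j : ℕ) :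
    ContinuousOn (fun P : SLProblem => (P.char N).coeff j) O := by
  have a1 := (slSol_coeff_cont N O hf 1 0 N).1 (by omega) j
  have a2 := (slSol_coeff_cont N O hf 1 0 N).2 (by omega) j
  have b1 := (slSol_coeff_cont N O hf 0 1 N).1 (by omega) j
  have b2 := (slSol_coeff_cont N O hf 0 1 N).2 (by omega) j
  have cf : ContinuousOn (fun P : SLProblem => (P.1 N : ℂ)) O := by fun_prop
  have cA : ∀ a b, ContinuousOn (fun P : SLProblem => P.2.2.2.1 a b) O := fun a b =>
    ((continuous_id.matrix_elem a b).comp (by fun_prop :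
      Continuous fun P : SLProblem => P.2.2.2.1)).continuousOn
  have cB : ∀ a b, ContinuousOn (fun P : SLProblem => P.2.2.2.2 a b) O := fun a b =>
    ((continuous_id.matrix_elem a b).comp (by fun_prop :
      Continuous fun P : SLProblem => P.2.2.2.2)).continuousOn
  simp only [SLProblem.char, slCharPoly, coeff_add, coeff_sub, coeff_C_mul, Matrix.det_fin_two]
  refine ContinuousOn.add (ContinuousOn.add (ContinuousOn.add (ContinuousOn.add ?_ ?_) ?_) ?_) ?_
  · simp only [coeff_C]
    split_ifs
    · fun_prop
    · exact continuousOn_const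
  · fun_prop
  · fun_prop
  · fun_prop
  · fun_prop

lemma sorted_filter_split (r1 r2 : ℝ) (hr : r1 < r2) (l : List ℝ) (hs : l.Pairwise (· ≤ ·)) :
    l.filter (fun x => x < r1 ∨ r2 < x) = l.filter (fun x => x < r1) ++ l.filter (fun x => r2 < x) := by
  induction l with
  | nil => rfl
  | cons a l ih =>
    rw [List.pairwise_cons] at hs
    have ih := ih hs.2
    by_cases h1 : a < r1
    · have h2 : ¬ r2 < a := by linarith
      simp [h1, h2] at ih ⊢
      exact ih
    · have h3 : l.filter (fun x => decide (x < r1)) = [] := by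
        rw [List.filter_eq_nil_iff]
        intro b hb
        have := hs.1 b hb
        simp; linarith
      rw [h3] at ih
      by_cases h2 : r2 < a
      · simp [h1, h2, h3] at ih ⊢
        exact ih
      · simp [h1, h2, h3] at ih ⊢
        exact ih

lemma filter_length (r1 r2 : ℝ) (hr : r1 < r2) (l : List ℝ) (h : ∀ x ∈ l, x ≠ r1 ∧ x ≠ r2) :
    (l.filter (fun x => r1 < x ∧ x < r2)).length + (l.filter (fun x => x < r1 ∨ r2 < x)).length
      = l.length := by
  induction l with
  | nil => rfl
  | cons a l ih =>
    have ih := ih (fun x hx => h x (List.mem_cons_of_mem _ hx))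
    have ha := h a (List.mem_cons_self)
    by_cases h1 : r1 < a ∧ a < r2
    · have h2 : ¬ (a < r1 ∨ r2 < a) := by
        rintro (h | h) <;> linarith [h1.1, h1.2]
      rw [List.filter_cons_of_pos (by simpa using h1), List.filter_cons_of_neg (by simpa using h2)]
      simp only [List.length_cons]; omega
    · have h2 : (a < r1 ∨ r2 < a) := by
        rcases lt_or_gt_of_ne ha.1 with h | h
        · exact Or.inl h
        · rcases lt_or_gt_of_ne ha.2 with h' | h'
          · exact absurd ⟨h, h'⟩ h1
          · exact Or.inr h'
      rw [List.filter_cons_of_neg (by simpa using h1), List.filter_cons_of_pos (by simpa using h2)]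
      simp only [List.length_cons]; omega

/-- Theorem 2.3(i): if every problem in a connected set `O` has exactly `k` eigenvalues,
exactly `m < k` of which lie in `(r₁, r₂)` with none equal to `r₁` or `r₂`, then for
each `1 ≤ i ≤ k-m`, the `i`-th eigenvalue outside `[r₁, r₂]` takes values either
entirely in `(-∞, r₁)` or entirely in `(r₂, +∞)` on `O`. -/
theorem hatEig_dichotomy (N k m : ℕ) (hN : 2 ≤ N) (hmk : m < k) (r1 r2 : ℝ)
    (hr : r1 < r2) (O : Set SLProblem) (hconn : IsConnected O)
    (hO : ∀ P ∈ O, IsSLP N P.1 P.2.1 P.2.2.1 P.2.2.2.1 P.2.2.2.2)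
    (hk : ∀ P ∈ O, P.char N ≠ 0 ∧ (eigList (P.char N)).length = k)
    (hm : ∀ P ∈ O,
      ((eigList (P.char N)).filter (fun x => r1 < x ∧ x < r2)).length = m)
    (hend : ∀ P ∈ O, ∀ x ∈ eigList (P.char N), x ≠ r1 ∧ x ≠ r2) :
    ∀ i : ℕ, 1 ≤ i → i ≤ k - m →
      (∀ P ∈ O, hatEig N r1 r2 P i < r1) ∨ (∀ P ∈ O, r2 < hatEig N r1 r2 P i) := by
  intro i hi1 hik
  have hf : ∀ P ∈ O, ∀ n ≤ N, P.1 n ≠ 0 := fun P hP => (hO P hP).1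
  have hreal : ∀ P ∈ O, ∀ z ∈ (P.char N).roots, z.im = 0 := fun P hP z hz =>
    char_root_real N hN _ _ _ _ _ (hO P hP) z (isRoot_of_mem_roots hz)
  have hfil : ∀ P ∈ O, (P.char N).roots.filter (fun z => z.im = 0) = (P.char N).roots :=
    fun P hP => Multiset.filter_eq_self.mpr (hreal P hP)
  have hcoe : ∀ P ∈ O, (↑(eigList (P.char N)) : Multiset ℝ) = (P.char N).roots.map Complex.re := by
    intro P hP
    rw [eigList, Multiset.sort_eq, hfil P hP]
  have hd : ∀ P ∈ O, (P.char N).natDegree = k := by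
    intro P hP
    rw [(IsAlgClosed.splits (P.char N)).natDegree_eq_card_roots, ← (hk P hP).2,
      ← Multiset.coe_card, hcoe P hP, Multiset.card_map]
  have hcont := continuousOn_rootCount O (fun P => P.char N) k r1 (char_coeff_cont N O hf)
    (fun P hP => (hk P hP).1) hd (by
      intro P hP z hz
      refine (hend P hP z.re ?_).1
      rw [← Multiset.mem_coe, hcoe P hP]
      exact Multiset.mem_map_of_mem _ hz)
  obtain ⟨P0, hP0⟩ := hconn.nonempty
  have hcount : ∀ P ∈ O, ((eigList (P.char N)).filter (fun x => x < r1)).length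
      = (P.char N).roots.countP (fun z => z.re < r1) := by
    intro P hP
    rw [← List.countP_eq_length_filter]
    have := congrArg (Multiset.countP (fun x : ℝ => x < r1)) (hcoe P hP)
    rw [Multiset.coe_countP, Multiset.countP_map, ← Multiset.countP_eq_card_filter] at this
    exact this
  have hconst : ∀ P ∈ O, ((eigList (P.char N)).filter (fun x => x < r1)).length
      = ((eigList (P0.char N)).filter (fun x => x < r1)).length := by
    intro P hP
    rw [hcount P hP, hcount P0 hP0]
    exact hconn.isPreconnected.constant hcont hP hP0
  have hsplit : ∀ P ∈ O, (eigList (P.char N)).filter (fun x => x < r1 ∨ r2 < x)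
      = (eigList (P.char N)).filter (fun x => x < r1)
        ++ (eigList (P.char N)).filter (fun x => r2 < x) := by
    intro P hP
    apply sorted_filter_split r1 r2 hr
    exact Multiset.pairwise_sort _ _
  have hlen : ∀ P ∈ O, ((eigList (P.char N)).filter (fun x => x < r1 ∨ r2 < x)).length = k - m := by
    intro P hP
    have h1 := filter_length r1 r2 hr _ (hend P hP)
    have h2 := hm P hP
    have h3 := (hk P hP).2
    omega
  by_cases hc : i - 1 < ((eigList (P0.char N)).filter (fun x => x < r1)).length
  · left
    intro P hP
    rw [← hconst P hP] at hc
    rw [hatEig, hsplit P hP, List.getD_append _ _ _ _ hc, List.getD_eq_getElem _ _ hc]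
    simpa using (List.mem_filter.mp (List.getElem_mem hc)).2
  · right
    intro P hP
    rw [← hconst P hP, not_lt] at hc
    have hl := hlen P hP
    rw [hsplit P hP, List.length_append] at hl
    have hlt : i - 1 - ((eigList (P.char N)).filter (fun x => x < r1)).length
      < ((eigList (P.char N)).filter (fun x => r2 < x)).length := by omega
    rw [hatEig, hsplit P hP, List.getD_append_right _ _ _ _ hc, List.getD_eq_getElem _ _ hlt]
    simpa using (List.mem_filter.mp (List.getElem_mem hlt)).2
end
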